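/- Let n ≥ 1, let r₁, r₂ > 0 and c ∈ ℝⁿ with c₀ ≥ 0, and suppose the Euclidean closed balls D₁ = closedBall(c, r₁) and D₀ = closedBall(0, r₂) are causally disjoint. Then for every δ with 0 ≤ δ < c₀, the δ-shift in the time direction D₁,δ = closedBall(c − δ•e₀, r₁) (where e₀ is the standard basis vector in the time coordinate) and D₀ are causally disjoint. -/

import Mathlib

open Set Metric unitInterval

noncomputable section

/-- `n`-dimensional Minkowski space, modeled as `ℝⁿ` with the Euclidean norm. -/
abbrev Mink (n : ℕ) := EuclideanSpace ℝ (Fin n)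

/-- The spatial part `x⃗ = (x 1, …, x (n-1)) ∈ ℝ^{n-1}` of `x ∈ ℝⁿ`. -/
def spatial {n : ℕ} (x : Mink n) : Mink (n - 1) :=
  (WithLp.equiv 2 _).symm fun i : Fin (n - 1) => x ⟨i.1 + 1, by have := i.isLt; omega⟩

/-- A curve `γ` is future-directed causal if it is `C¹` and
`(γ₀)'(t) ≥ ‖(γ⃗)'(t)‖` for all `t ∈ [0,1]`. -/
def FDCausal {n : ℕ} [NeZero n] (γ : ℝ → Mink n) : Prop :=
  ContDiff ℝ 1 γ ∧
    ∀ t ∈ Set.Icc (0 : ℝ) 1,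
      ‖deriv (fun s => spatial (γ s)) t‖ ≤ deriv (fun s => γ s 0) t

/-- A curve `γ` is past-directed causal if it is `C¹` and
`-(γ₀)'(t) ≥ ‖(γ⃗)'(t)‖` for all `t ∈ [0,1]`. -/
def PDCausal {n : ℕ} [NeZero n] (γ : ℝ → Mink n) : Prop :=
  ContDiff ℝ 1 γ ∧
    ∀ t ∈ Set.Icc (0 : ℝ) 1,
      ‖deriv (fun s => spatial (γ s)) t‖ ≤ -(deriv (fun s => γ s 0) t)

/-- A causal curve is a future- or past-directed causal curve. -/
def IsCausalCurve {n : ℕ} [NeZero n] (γ : ℝ → Mink n) : Prop :=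
  FDCausal γ ∨ PDCausal γ

/-- `S` and `T` are causally disjoint if no causal curve starts in `S` and ends in `T`. -/
def CausallyDisjoint {n : ℕ} [NeZero n] (S T : Set (Mink n)) : Prop :=
  ¬ ∃ γ : ℝ → Mink n, IsCausalCurve γ ∧ γ 0 ∈ S ∧ γ 1 ∈ T

/-- The spatial part as a continuous linear map. -/
def spatialCLM (n : ℕ) : Mink n →L[ℝ] Mink (n - 1) :=
  LinearMap.toContinuousLinearMap
    { toFun := spatial
      map_add' := fun x y => by ext i; simp [spatial]
      map_smul' := fun a x => by ext i; simp [spatial] }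

theorem spatialCLM_apply {n : ℕ} (x : Mink n) : spatialCLM n x = spatial x := rfl

theorem spatial_single_zero {n : ℕ} [NeZero n] (a : ℝ) :
    spatial (EuclideanSpace.single (0 : Fin n) a) = 0 := by
  ext i
  simp [spatial, Fin.ext_iff]

/-- If the speed of a `C¹` curve `f` is bounded by the derivative of `B` on `[0,1]`, then its
displacement is bounded by that of `B`. -/
theorem norm_sub_le_of_norm_deriv_le_deriv {E : Type*} [NormedAddCommGroup E] [NormedSpace ℝ E]
    {f : ℝ → E} {B : ℝ → ℝ} (hf : Differentiable ℝ f) (hB : Differentiable ℝ B)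
    (h : ∀ t ∈ Icc (0 : ℝ) 1, ‖deriv f t‖ ≤ deriv B t) : ‖f 1 - f 0‖ ≤ B 1 - B 0 := by
  refine image_norm_le_of_norm_deriv_right_le_deriv_boundary' (a := 0) (b := 1)
    (f := fun t => f t - f 0) (f' := deriv f) (B := fun t => B t - B 0) (B' := deriv B)
    (hf.continuous.sub continuous_const).continuousOn
    (fun t _ => ((hf t).hasDerivAt.sub_const _).hasDerivWithinAt) (by simp)
    (hB.continuous.sub continuous_const).continuousOn
    (fun t _ => ((hB t).hasDerivAt.sub_const _).hasDerivWithinAt)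
    (fun t ht => h t (Ico_subset_Icc_self ht)) (right_mem_Icc.2 zero_le_one)

theorem IsCausalCurve.norm_spatial_sub_le {n : ℕ} [NeZero n] {γ : ℝ → Mink n}
    (hγ : IsCausalCurve γ) : ‖spatial (γ 0 - γ 1)‖ ≤ |(γ 0 - γ 1) 0| := by
  have hd : ContDiff ℝ 1 γ := hγ.elim And.left And.left
  have hγ' : Differentiable ℝ γ := hd.differentiable one_ne_zero
  have hs : Differentiable ℝ fun t => spatial (γ t) := (spatialCLM n).differentiable.comp hγ'
  have h0 : Differentiable ℝ fun t => γ t 0 :=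
    (EuclideanSpace.proj (𝕜 := ℝ) (0 : Fin n)).differentiable.comp hγ'
  have hsub : spatial (γ 0 - γ 1) = spatial (γ 0) - spatial (γ 1) := map_sub (spatialCLM n) _ _
  rw [hsub, norm_sub_rev, PiLp.sub_apply]
  rcases hγ with hγ | hγ
  · have := norm_sub_le_of_norm_deriv_le_deriv hs h0 hγ.2
    rw [abs_sub_comm]
    exact this.trans (le_abs_self _)
  · have := norm_sub_le_of_norm_deriv_le_deriv hs h0.neg
      fun t ht => (hγ.2 t ht).trans_eq deriv.fun_neg.symm
    refine this.trans ((le_of_eq ?_).trans (le_abs_self _))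
    simp only [Pi.neg_apply]
    ring

/-- The straight segment between two points with future-causal difference is past-directed. -/
theorem pdCausal_segment {n : ℕ} [NeZero n] {x y : Mink n}
    (h : ‖spatial (x - y)‖ ≤ (x - y) 0) : PDCausal fun t : ℝ => x - t • (x - y) := by
  have hd (t : ℝ) : HasDerivAt (fun t : ℝ => x - t • (x - y)) (-(x - y)) t := by
    simpa using ((hasDerivAt_id t).smul_const (x - y)).const_sub x
  refine ⟨by fun_prop, fun t _ => ?_⟩
  have hs : HasDerivAt (fun s : ℝ => spatial (x - s • (x - y))) (spatialCLM n (-(x - y))) t :=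
    (spatialCLM n).hasFDerivAt.comp_hasDerivAt t (hd t)
  have h0 : HasDerivAt (fun s : ℝ => (x - s • (x - y)) 0) ((-(x - y)) 0) t :=
    (EuclideanSpace.proj (𝕜 := ℝ) (0 : Fin n)).hasFDerivAt.comp_hasDerivAt t (hd t)
  rw [hs.deriv, h0.deriv, map_neg, norm_neg, spatialCLM_apply, PiLp.neg_apply, neg_neg]
  exact h

open scoped Pointwise in
/-- A vector within `r + s` of `c` is the difference of points of the balls of radii `r`, `s`
around `c` and the origin. -/
theorem exists_sub_eq_of_norm_sub_le_add {E : Type*} [NormedAddCommGroup E] [NormedSpace ℝ E]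
    [ProperSpace E] {r s : ℝ} (hr : 0 ≤ r) (hs : 0 ≤ s) {c w : E} (hw : ‖w - c‖ ≤ r + s) :
    ∃ x ∈ closedBall c r, ∃ y ∈ closedBall (0 : E) s, x - y = w := by
  have hmem : w ∈ closedBall c r - closedBall (0 : E) s := by
    rw [closedBall_sub_closedBall hr hs, sub_zero, mem_closedBall_iff_norm]
    exact hw
  simpa only [Set.mem_sub] using hmem

/-- Shifting a ball by `δ` in the time direction towards the time-zero hyperplane
preserves causal disjointness from a ball centered at the origin. -/
theorem causallyDisjoint_shift (n : ℕ) [NeZero n] (hn : 1 ≤ n)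
    (r₁ r₂ : ℝ) (hr₁ : 0 < r₁) (hr₂ : 0 < r₂) (c : Mink n) (hc : 0 ≤ c 0)
    (h : CausallyDisjoint (closedBall c r₁) (closedBall (0 : Mink n) r₂))
    (δ : ℝ) (hδ₀ : 0 ≤ δ) (hδ₁ : δ < c 0) :
    CausallyDisjoint
      (closedBall (c - δ • EuclideanSpace.single (0 : Fin n) (1 : ℝ)) r₁)
      (closedBall (0 : Mink n) r₂) := by
  rintro ⟨γ, hγ, hx, hy⟩
  apply h
  set e : Mink n := EuclideanSpace.single (0 : Fin n) (1 : ℝ) with he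
  set v := γ 0 - γ 1 with hv
  have hcausal : ‖spatial v‖ ≤ |v 0| := hγ.norm_spatial_sub_le
  have hdist : ‖v - (c - δ • e)‖ ≤ r₁ + r₂ := by
    rw [mem_closedBall_iff_norm] at hx hy
    rw [sub_zero] at hy
    calc ‖v - (c - δ • e)‖ = ‖(γ 0 - (c - δ • e)) - γ 1‖ := by rw [hv, sub_right_comm]
      _ ≤ _ := (norm_sub_le _ _).trans (add_le_add hx hy)
  -- reflect `v` into the future cone, then shift by `δ`
  set w : Mink n := v + (|v 0| + δ - v 0) • e with hw
  have hw0 : w 0 = |v 0| + δ := by simp [hw, he]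
  have hws : spatial w = spatial v := by
    rw [← spatialCLM_apply, hw, map_add, map_smul, spatialCLM_apply, spatialCLM_apply, he,
      spatial_single_zero, smul_zero, add_zero]
  have hwdist : ‖w - c‖ ≤ ‖v - (c - δ • e)‖ := by
    rw [EuclideanSpace.norm_eq, EuclideanSpace.norm_eq]
    refine Real.sqrt_le_sqrt (Finset.sum_le_sum fun i _ => ?_)
    rw [Real.norm_eq_abs, Real.norm_eq_abs, sq_le_sq, abs_abs, abs_abs]
    by_cases hi : i = 0
    · subst hi
      have h1 : (v - (c - δ • e)) 0 = v 0 - (c 0 - δ) := by simp [he]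
      rw [h1, PiLp.sub_apply, hw0]
      have := abs_abs_sub_abs_le (v 0) (c 0 - δ)
      rwa [abs_of_nonneg (sub_nonneg.2 hδ₁.le), sub_sub_eq_add_sub] at this
    · simp [hw, he, hi]
  obtain ⟨x, hx, y, hy, hxy⟩ :=
    exists_sub_eq_of_norm_sub_le_add hr₁.le hr₂.le (hwdist.trans hdist)
  refine ⟨fun t => x - t • (x - y), Or.inr (pdCausal_segment ?_), by simpa using hx,
    by simpa using hy⟩
  rw [hxy, hws, hw0]
  linarith
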